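/- Let ε > 0. Suppose V : ℝ³ → ℝ³ is smooth and satisfies the conformal Killing equation ∂_i V_j + ∂_j V_i = (2/3)(div V) δ_{ij} on all of ℝ³, and suppose that ∫_{ℝ³} ‖V(x)‖² (1 + ‖x‖²)^{(4ε−3)/2} dx < ∞. Then V ≡ 0. -/

import Mathlib

open MeasureTheory
open scoped ENNReal

/-- The partial derivative `∂_i w` of a scalar function `w` on `ℝ³` in the `i`-th
coordinate direction. -/
noncomputable def pd (i : Fin 3) (w : EuclideanSpace ℝ (Fin 3) → ℝ)
    (x : EuclideanSpace ℝ (Fin 3)) : ℝ :=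
  fderiv ℝ w x (EuclideanSpace.single i 1)

open Polynomial Filter Set

/-- For a function with finite integral, almost every radial integral (with the polar Jacobian)
is finite. -/
theorem ae_toSphere_lintegral_ray_lt_top {E : Type*} [NormedAddCommGroup E] [NormedSpace ℝ E]
    [FiniteDimensional ℝ E] [MeasurableSpace E] [BorelSpace E] [Nontrivial E]
    (μ : Measure E) [μ.IsAddHaarMeasure] {f : E → ℝ≥0∞} (hf : Measurable f)
    (hint : ∫⁻ x, f x ∂μ < ⊤) :
    ∀ᵐ u : Metric.sphere (0 : E) 1 ∂μ.toSphere, ∫⁻ r in Ioi (0 : ℝ),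
      ENNReal.ofReal (r ^ (Module.finrank ℝ E - 1)) * f (r • (u : E)) < ⊤ := by
  have hpolar : ∫⁻ x, f x ∂μ = ∫⁻ z, f ((z.2 : ℝ) • (z.1 : E))
      ∂μ.toSphere.prod (.volumeIoiPow (Module.finrank ℝ E - 1)) := by
    rw [← μ.measurePreserving_homeomorphUnitSphereProd.lintegral_comp_emb
      (Homeomorph.measurableEmbedding _), ← restrict_compl_singleton (μ := μ) 0,
      ← lintegral_subtype_comap (measurableSet_singleton _).compl, restrict_compl_singleton]
    refine lintegral_congr fun x => ?_
    have hx : ‖(x : E)‖ ≠ 0 := norm_ne_zero_iff.2 x.2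
    simp [smul_smul, hx]
  have hmeas : Measurable fun z : Metric.sphere (0 : E) 1 × Ioi (0 : ℝ) =>
      f ((z.2 : ℝ) • (z.1 : E)) := hf.comp (by fun_prop)
  rw [hpolar, lintegral_prod _ hmeas.aemeasurable] at hint
  filter_upwards [ae_lt_top hmeas.lintegral_prod_right' hint.ne] with u hu
  have hu_meas : Measurable fun r : Ioi (0 : ℝ) => f ((r : ℝ) • (u : E)) :=
    hf.comp (by fun_prop)
  rw [Measure.volumeIoiPow, lintegral_withDensity_eq_lintegral_mul _ (by fun_prop) hu_meas] at hu
  rwa [← lintegral_subtype_comap measurableSet_Ioi]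

theorem Polynomial.exists_pos_eventually_le_sq_eval {p : ℝ[X]} (hp : p ≠ 0) :
    ∃ c > 0, ∀ᶠ r in atTop, c ≤ p.eval r ^ 2 := by
  by_cases hdeg : 0 < p.degree
  · refine ⟨1, one_pos, ?_⟩
    filter_upwards [(p.abs_tendsto_atTop hdeg).eventually_ge_atTop 1] with r hr
    exact (one_le_sq_iff_one_le_abs _).2 hr
  · obtain ⟨a, rfl⟩ : ∃ a, p = C a := ⟨_, eq_C_of_degree_le_zero (not_lt.1 hdeg)⟩
    have ha : a ≠ 0 := by simpa using hp
    exact ⟨a ^ 2, by positivity, by simp⟩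

/-- In three dimensions the radial weight is at least of the borderline order `1 / r`. -/
theorem inv_div_eight_le_sq_mul_weight {ε r : ℝ} (hε : 0 ≤ ε) (hr : 1 ≤ r) :
    r⁻¹ / 8 ≤ r ^ 2 * (1 + r ^ 2) ^ ((4 * ε - 3) / 2) := by
  have hr0 : 0 < r := by linarith
  have hweight : ((2 * r) ^ 3)⁻¹ ≤ (1 + r ^ 2) ^ ((4 * ε - 3) / 2) :=
    calc ((2 * r) ^ 3)⁻¹ = ((2 * r) ^ 2) ^ (-3 / 2 : ℝ) := by
          rw [← Real.rpow_natCast (2 * r) 2, ← Real.rpow_mul (by positivity),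
            ← Real.rpow_natCast, ← Real.rpow_neg (by positivity)]
          norm_num
      _ ≤ (1 + r ^ 2) ^ (-3 / 2 : ℝ) :=
          Real.rpow_le_rpow_of_nonpos (by positivity) (by nlinarith) (by norm_num)
      _ ≤ (1 + r ^ 2) ^ ((4 * ε - 3) / 2) :=
          Real.rpow_le_rpow_of_exponent_le (by nlinarith) (by linarith)
  calc r⁻¹ / 8 = r ^ 2 * ((2 * r) ^ 3)⁻¹ := by field_simp; norm_num
    _ ≤ _ := by gcongr

theorem Polynomial.eq_zero_of_lintegral_radial_weight_lt_top {ε : ℝ} (hε : 0 ≤ ε) {p : ℝ[X]}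
    (hint : ∫⁻ r in Ioi (0 : ℝ), ENNReal.ofReal (r ^ 2) *
      ENNReal.ofReal (p.eval r ^ 2 * (1 + r ^ 2) ^ ((4 * ε - 3) / 2)) < ⊤) : p = 0 := by
  by_contra hp
  obtain ⟨c, hc, hev⟩ := exists_pos_eventually_le_sq_eval hp
  obtain ⟨R, hR⟩ := eventually_atTop.1 (hev.and (eventually_ge_atTop 1))
  have hR1 : 1 ≤ R := (hR R le_rfl).2
  have hfin : ∫⁻ r in Ioi R, ENNReal.ofReal (c / 8 * r⁻¹) < ⊤ := by
    refine lt_of_le_of_lt (le_trans ?_ (lintegral_mono_set (Ioi_subset_Ioi (by linarith)))) hint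
    refine setLIntegral_mono' measurableSet_Ioi fun r hr => ?_
    obtain ⟨hcr, hr1⟩ := hR r (le_of_lt hr)
    rw [← ENNReal.ofReal_mul (by positivity)]
    refine ENNReal.ofReal_le_ofReal ?_
    have hw := inv_div_eight_le_sq_mul_weight hε hr1
    have hr0 : 0 < r := by linarith
    calc c / 8 * r⁻¹ = c * (r⁻¹ / 8) := by ring
      _ ≤ p.eval r ^ 2 * (r ^ 2 * (1 + r ^ 2) ^ ((4 * ε - 3) / 2)) := by gcongr
      _ = _ := by ring
  have hI : IntegrableOn (fun r : ℝ => c / 8 * r⁻¹) (Ioi R) := by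
    refine ⟨by fun_prop, ?_⟩
    rw [hasFiniteIntegral_iff_ofReal]
    · exact hfin
    · filter_upwards [ae_restrict_mem measurableSet_Ioi] with r hr
      have hr0 : 0 < r := by linarith [mem_Ioi.1 hr]
      positivity
  refine not_integrableOn_Ioi_inv (a := R) ?_
  have := hI.const_mul (8 / c)
  refine this.congr (ae_of_all _ fun r => ?_)
  simp only
  field_simp

theorem Polynomial.derivative_surjective_real : Function.Surjective (derivative (R := ℝ)) := by
  intro p
  induction p using Polynomial.induction_on' with
  | add p q hp hq =>
    obtain ⟨P, rfl⟩ := hp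
    obtain ⟨Q, rfl⟩ := hq
    exact ⟨P + Q, by simp⟩
  | monomial n a =>
    refine ⟨monomial (n + 1) (a / (n + 1)), ?_⟩
    rw [derivative_monomial]
    congr 1
    push_cast
    field_simp

/-- A function is polynomial along every line through the origin. -/
def IsRayPolynomial {E : Type*} [AddCommGroup E] [Module ℝ E] (w : E → ℝ) : Prop :=
  ∀ u : E, ∃ p : ℝ[X], ∀ t : ℝ, w (t • u) = p.eval t

theorem fderiv_apply_eq_sum_pd (w : EuclideanSpace ℝ (Fin 3) → ℝ)
    (x u : EuclideanSpace ℝ (Fin 3)) : fderiv ℝ w x u = ∑ i, u i * pd i w x := by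
  conv_lhs => rw [← (EuclideanSpace.basisFun (Fin 3) ℝ).sum_repr u]
  simp [pd]

theorem isRayPolynomial_of_pd {w : EuclideanSpace ℝ (Fin 3) → ℝ} (hw : Differentiable ℝ w)
    (h : ∀ i, IsRayPolynomial (pd i w)) : IsRayPolynomial w := by
  intro u
  choose p hp using fun i => h i u
  obtain ⟨q, hq⟩ := derivative_surjective_real (∑ i, C (u i) * p i)
  have hderiv (t : ℝ) : HasDerivAt (fun t : ℝ => w (t • u) - q.eval t) 0 t := by
    have hline : HasDerivAt (fun t : ℝ => t • u) u t := by
      simpa using (hasDerivAt_id t).smul_const u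
    have hsub := ((hw (t • u)).hasFDerivAt.comp_hasDerivAt t hline).sub (q.hasDerivAt t)
    have hzero : fderiv ℝ w (t • u) u - (derivative q).eval t = 0 := by
      rw [hq, fderiv_apply_eq_sum_pd, eval_finsetSum]
      simp [hp]
    rwa [hzero] at hsub
  refine ⟨q + C (w 0 - q.eval 0), fun t => ?_⟩
  have hconst := is_const_of_deriv_eq_zero (fun t => (hderiv t).differentiableAt)
    (fun t => (hderiv t).deriv) t 0
  simp only [zero_smul] at hconst
  simp only [eval_add, eval_C]
  linarith

theorem ContDiff.pd {w : EuclideanSpace ℝ (Fin 3) → ℝ} (hw : ContDiff ℝ (⊤ : ℕ∞) w) (i : Fin 3) :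
    ContDiff ℝ (⊤ : ℕ∞) (pd i w) :=
  (hw.fderiv_right (m := (⊤ : ℕ∞)) (by norm_cast)).clm_apply contDiff_const

theorem pd_comm {w : EuclideanSpace ℝ (Fin 3) → ℝ} (hw : ContDiff ℝ (⊤ : ℕ∞) w) (i j : Fin 3) :
    pd i (pd j w) = pd j (pd i w) := by
  have hd : Differentiable ℝ (fderiv ℝ w) :=
    (hw.fderiv_right (m := (⊤ : ℕ∞)) (by norm_cast)).differentiable (by simp)
  have hexpand (k l : Fin 3) (x : EuclideanSpace ℝ (Fin 3)) : pd k (pd l w) x =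
      fderiv ℝ (fderiv ℝ w) x (EuclideanSpace.single k 1) (EuclideanSpace.single l 1) := by
    change fderiv ℝ (fun y => fderiv ℝ w y (EuclideanSpace.single l 1)) x _ = _
    rw [fderiv_clm_apply (hd x) (differentiableAt_const _)]
    simp
  ext x
  rw [hexpand, hexpand]
  exact (hw.contDiffAt.isSymmSndFDerivAt (by simp; norm_cast)) _ _

theorem pd_add {v w : EuclideanSpace ℝ (Fin 3) → ℝ} (hv : Differentiable ℝ v)
    (hw : Differentiable ℝ w) (i : Fin 3) : pd i (v + w) = pd i v + pd i w := by
  ext x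
  simp [pd, fderiv_add (hv x) (hw x)]

theorem pd_const_smul {w : EuclideanSpace ℝ (Fin 3) → ℝ} (hw : Differentiable ℝ w) (c : ℝ)
    (i : Fin 3) : pd i (c • w) = c • pd i w := by
  ext x
  simp [pd, fderiv_const_smul (hw x)]

theorem pd_sum {w : Fin 3 → EuclideanSpace ℝ (Fin 3) → ℝ} (hw : ∀ l, Differentiable ℝ (w l))
    (i : Fin 3) : pd i (∑ l, w l) = ∑ l, pd i (w l) := by
  ext x
  simp [pd, fderiv_sum fun l _ => hw l x]

/-- The linear algebra behind the vanishing of the third derivatives of a conformal Killing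
field in dimension three. -/
theorem eq_zero_of_conformalKilling_symbol {T : Fin 3 → Fin 3 → Fin 3 → Fin 3 → ℝ}
    (hswap : ∀ l m i j, T l m i j = T m l i j) (hswap' : ∀ l m i j, T l m i j = T l i m j)
    (hCK : ∀ l m i j, T l m i j + T l m j i =
      2 / 3 * (∑ p, T l m p p) * (if i = j then 1 else 0)) (l m i j : Fin 3) :
    T l m i j = 0 := by
  set F : Fin 3 → Fin 3 → ℝ := fun l m => (∑ p, T l m p p) / 3 with hF
  have hF_symm (l m : Fin 3) : F l m = F m l := by simp only [hF, hswap l m]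
  have hT (l i j k : Fin 3) : T l i j k = F l i * (if j = k then 1 else 0) +
      F l j * (if i = k then 1 else 0) - F l k * (if i = j then 1 else 0) := by
    have h₁ := hCK l i j k
    have h₂ := hCK l j i k
    have h₃ := hCK l k i j
    simp only [hF]
    linarith [hswap' l i j k, hswap' l i k j, hswap' l j k i]
  have hdiag (a b : Fin 3) (hab : a ≠ b) : F a a = - F b b := by
    have h := hswap a b a b
    have h₁ := hT a a b b
    have h₂ := hT b a a b
    have h₃ := hswap' a a b b
    simp [hab] at h₁ h₂
    linarith
  have hoff (a b c : Fin 3) (hab : a ≠ b) (hac : a ≠ c) (hbc : b ≠ c) : F a b = 0 := by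
    have h := hswap a c b c
    have h₁ := hT a b c c
    have h₂ := hT c a b c
    have h₃ := hswap' a b c c
    simp [hab, hac, hbc] at h₁ h₂
    linarith
  have hF_zero (a b : Fin 3) : F a b = 0 := by
    have h₁ := hdiag 0 1 (by decide)
    have h₂ := hdiag 1 2 (by decide)
    have h₃ := hdiag 0 2 (by decide)
    by_cases hab : a = b
    · subst hab
      fin_cases a <;> simp only [Fin.zero_eta, Fin.mk_one, Fin.reduceFinMk] <;> linarith
    · obtain ⟨c, hac, hbc⟩ : ∃ c, a ≠ c ∧ b ≠ c := by revert a b; decide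
      exact hoff a b c hab hac hbc
  rw [hT]
  simp [hF_zero]

theorem pd_pd_pd_eq_zero_of_conformalKilling
    {v : Fin 3 → EuclideanSpace ℝ (Fin 3) → ℝ} (hv : ∀ k, ContDiff ℝ (⊤ : ℕ∞) (v k))
    (hCK : ∀ x i j, pd i (v j) x + pd j (v i) x =
      2 / 3 * (∑ l, pd l (v l) x) * (if i = j then 1 else 0)) (l m i j : Fin 3) :
    pd l (pd m (pd i (v j))) = 0 := by
  have hd {w : EuclideanSpace ℝ (Fin 3) → ℝ} (hw : ContDiff ℝ (⊤ : ℕ∞) w) :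
      Differentiable ℝ w := hw.differentiable (by simp)
  have hfun (i j : Fin 3) : pd i (v j) + pd j (v i) =
      (2 / 3 * (if i = j then 1 else 0) : ℝ) • ∑ l, pd l (v l) := by
    ext x
    simp only [Pi.add_apply, Pi.smul_apply, Finset.sum_apply, smul_eq_mul, hCK x i j]
    ring
  have hfun' (l m i j : Fin 3) : pd l (pd m (pd i (v j))) + pd l (pd m (pd j (v i))) =
      (2 / 3 * (if i = j then 1 else 0) : ℝ) • ∑ p, pd l (pd m (pd p (v p))) := by
    have h := congrArg (fun w => pd l (pd m w)) (hfun i j)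
    have hsum : ContDiff ℝ (⊤ : ℕ∞) (∑ p, pd p (v p)) := by
      rw [show (∑ p, pd p (v p)) = fun x => ∑ p, pd p (v p) x by ext x; simp]
      exact ContDiff.sum fun p _ => (hv p).pd p
    rwa [pd_add (hd ((hv _).pd _)) (hd ((hv _).pd _)),
      pd_add (hd (((hv _).pd _).pd _)) (hd (((hv _).pd _).pd _)),
      pd_const_smul (hd hsum), pd_const_smul (hd (hsum.pd _)),
      pd_sum fun p => hd ((hv p).pd p), pd_sum fun p => hd (((hv p).pd p).pd m)] at h
  ext x
  refine eq_zero_of_conformalKilling_symbol (T := fun l m i j => pd l (pd m (pd i (v j))) x)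
    (fun l m i j => ?_) (fun l m i j => ?_) (fun l m i j => ?_) l m i j
  · simp only [pd_comm ((hv j).pd i) l m]
  · simp only [pd_comm (hv j) m i]
  · have h := congrFun (hfun' l m i j) x
    simp only [Pi.add_apply, Pi.smul_apply, Finset.sum_apply, smul_eq_mul] at h
    linarith

theorem isRayPolynomial_of_conformalKilling
    {v : Fin 3 → EuclideanSpace ℝ (Fin 3) → ℝ} (hv : ∀ k, ContDiff ℝ (⊤ : ℕ∞) (v k))
    (hCK : ∀ x i j, pd i (v j) x + pd j (v i) x =
      2 / 3 * (∑ l, pd l (v l) x) * (if i = j then 1 else 0)) (k : Fin 3) :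
    IsRayPolynomial (v k) := by
  have hd {w : EuclideanSpace ℝ (Fin 3) → ℝ} (hw : ContDiff ℝ (⊤ : ℕ∞) w) :
      Differentiable ℝ w := hw.differentiable (by simp)
  refine isRayPolynomial_of_pd (hd (hv k)) fun i =>
    isRayPolynomial_of_pd (hd ((hv k).pd i)) fun j =>
    isRayPolynomial_of_pd (hd (((hv k).pd i).pd j)) fun l u => ⟨0, fun t => ?_⟩
  simp [pd_pd_pd_eq_zero_of_conformalKilling hv hCK]

/-- A continuous ray-polynomial function on `ℝ³` in the weighted `L²` space is zero. -/
theorem IsRayPolynomial.eq_zero_of_lintegral_lt_top {ε : ℝ} (hε : 0 ≤ ε)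
    {w : EuclideanSpace ℝ (Fin 3) → ℝ} (hw : Continuous w) (hray : IsRayPolynomial w)
    (hint : ∫⁻ x, ENNReal.ofReal (w x ^ 2 * (1 + ‖x‖ ^ 2) ^ ((4 * ε - 3) / 2)) < ⊤)
    (x : EuclideanSpace ℝ (Fin 3)) : w x = 0 := by
  have hae : ∀ᵐ u : Metric.sphere (0 : EuclideanSpace ℝ (Fin 3)) 1
      ∂(volume : Measure (EuclideanSpace ℝ (Fin 3))).toSphere,
      ∀ t : ℝ, w (t • (u : EuclideanSpace ℝ (Fin 3))) = 0 := by
    filter_upwards [ae_toSphere_lintegral_ray_lt_top volume (by fun_prop) hint] with u hu t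
    obtain ⟨p, hp⟩ := hray u
    have hnorm (r : ℝ) : ‖r • (u : EuclideanSpace ℝ (Fin 3))‖ ^ 2 = r ^ 2 := by
      simp [norm_smul]
    simp only [hnorm, hp, finrank_euclideanSpace, Fintype.card_fin] at hu
    rw [hp, eq_zero_of_lintegral_radial_weight_lt_top hε hu, eval_zero]
  have hzero (t : ℝ) : (fun u : Metric.sphere (0 : EuclideanSpace ℝ (Fin 3)) 1 =>
      w (t • (u : EuclideanSpace ℝ (Fin 3)))) = fun _ => 0 :=
    Continuous.ae_eq_iff_eq (volume : Measure (EuclideanSpace ℝ (Fin 3))).toSphere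
      (by fun_prop) continuous_const |>.1 (hae.mono fun u hu => hu t)
  obtain ⟨u, hu⟩ : ∃ u : Metric.sphere (0 : EuclideanSpace ℝ (Fin 3)) 1,
      ‖x‖ • (u : EuclideanSpace ℝ (Fin 3)) = x := by
    by_cases hx : x = 0
    · exact ⟨⟨EuclideanSpace.single 0 1, by simp⟩, by simp [hx]⟩
    · have hx' : ‖x‖ ≠ 0 := norm_ne_zero_iff.2 hx
      exact ⟨⟨‖x‖⁻¹ • x, by simp [norm_smul, hx']⟩, by simp [smul_smul, hx']⟩
  rw [← hu]
  exact congrFun (hzero ‖x‖) u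

/-- A smooth conformal Killing field `V` on Euclidean `ℝ³` lying in the
weighted space `L²((1+‖x‖²)^{(4ε-3)/2} dx)` for some `ε > 0` vanishes identically. -/
theorem stmt_14 (ε : ℝ) (hε : 0 < ε)
    (V : EuclideanSpace ℝ (Fin 3) → EuclideanSpace ℝ (Fin 3))
    (hV : ContDiff ℝ (⊤ : ℕ∞) V)
    (hCK : ∀ (x : EuclideanSpace ℝ (Fin 3)) (i j : Fin 3),
      pd i (fun y => V y j) x + pd j (fun y => V y i) x =
        2 / 3 * (∑ l, pd l (fun y => V y l) x) * (if i = j then 1 else 0))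
    (hL2 : ∫⁻ x, ENNReal.ofReal
        (‖V x‖ ^ 2 * (1 + ‖x‖ ^ 2) ^ ((4 * ε - 3) / 2)) < ⊤) :
    ∀ x, V x = 0 := by
  intro x
  have hv (k : Fin 3) : ContDiff ℝ (⊤ : ℕ∞) fun y => V y k := by fun_prop
  ext k
  refine (isRayPolynomial_of_conformalKilling hv hCK k).eq_zero_of_lintegral_lt_top hε.le
    (hv k).continuous (lt_of_le_of_lt (lintegral_mono fun y => ?_) hL2) x
  refine ENNReal.ofReal_le_ofReal ?_
  have hcoord : V y k ^ 2 ≤ ‖V y‖ ^ 2 :=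
    sq_le_sq.2 (by simpa using PiLp.norm_apply_le (V y) k)
  gcongr
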